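/- Let n ∈ ℕ with n ≥ 2 and let v₁, v₂, α₁, α₂ be positive real numbers. Define, for real t in a neighborhood of 0, g(t) = (1 − ((1+t)^n − 1)(v₁/v₂))^{1/n} and f(t) = α₁ (1+t)^{n−1} + α₂ g(t)^{n−1}. Then f does not have a local minimum at t = 0. -/

import Mathlib

/-- The volume-preserving dilation factor `g(t) = (1 - ((1+t)^n - 1)·(v₁/v₂))^(1/n)`. -/
noncomputable def gfun (n : ℕ) (ρ : ℝ) (t : ℝ) : ℝ :=
  (1 - ((1 + t) ^ n - 1) * ρ) ^ ((1 : ℝ) / n)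

/-- The energy `f(t) = α₁ (1+t)^(n-1) + α₂ g(t)^(n-1)` of the dilated competitor. -/
noncomputable def ffun (n : ℕ) (v₁ v₂ α₁ α₂ : ℝ) (t : ℝ) : ℝ :=
  α₁ * (1 + t) ^ (n - 1) + α₂ * (gfun n (v₁ / v₂) t) ^ (n - 1)

/-- Strict midpoint concavity of `x ↦ x ^ p` at `1`, for `0 < p < 1`. -/
theorem one_add_rpow_add_one_sub_rpow_lt_two {p x : ℝ} (hp₀ : 0 < p) (hp₁ : p < 1)
    (hx₀ : 0 < x) (hx₁ : x < 1) : (1 + x) ^ p + (1 - x) ^ p < 2 := by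
  have h := (Real.strictConcaveOn_rpow hp₀ hp₁).2
    (Set.mem_Ici.2 (show 0 ≤ 1 + x by linarith)) (Set.mem_Ici.2 (show 0 ≤ 1 - x by linarith))
    (by linarith) (show (0 : ℝ) < 1 / 2 by norm_num) (show (0 : ℝ) < 1 / 2 by norm_num)
    (by norm_num)
  simp only [smul_eq_mul] at h
  rw [show (1 / 2 : ℝ) * (1 + x) + 1 / 2 * (1 - x) = 1 by ring, Real.one_rpow] at h
  linarith

theorem rpow_one_div_pow_pred {n : ℕ} (hn : 1 ≤ n) {s : ℝ} (hs : 0 ≤ s) :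
    (s ^ ((1 : ℝ) / n)) ^ (n - 1) = s ^ (((n : ℝ) - 1) / n) := by
  rw [← Real.rpow_natCast, ← Real.rpow_mul hs, Nat.cast_sub hn]
  congr 1
  push_cast
  ring

/-- In the volume variable `s = (1 + t) ^ n` the energy is a sum of concave powers. -/
theorem ffun_rpow_one_div_sub_one {n : ℕ} (hn : 1 ≤ n) (v₁ v₂ α₁ α₂ : ℝ) {s : ℝ} (hs : 0 ≤ s)
    (hs' : 0 ≤ 1 - (s - 1) * (v₁ / v₂)) :
    ffun n v₁ v₂ α₁ α₂ (s ^ ((1 : ℝ) / n) - 1) =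
      α₁ * s ^ (((n : ℝ) - 1) / n) +
        α₂ * (1 - (s - 1) * (v₁ / v₂)) ^ (((n : ℝ) - 1) / n) := by
  have hpow : (s ^ ((1 : ℝ) / n)) ^ n = s := by
    rw [one_div, Real.rpow_inv_natCast_pow hs (by omega)]
  rw [ffun, gfun, add_sub_cancel, hpow, rpow_one_div_pow_pred hn hs,
    rpow_one_div_pow_pred hn hs']

/-- Step 5 of the proof of Theorem 5.3: the energy `f` of the two-component competitor
does not have a local minimum at `t = 0`. -/
theorem stmt_5 (n : ℕ) (hn : 2 ≤ n) (v₁ v₂ α₁ α₂ : ℝ)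
    (hv₁ : 0 < v₁) (hv₂ : 0 < v₂) (hα₁ : 0 < α₁) (hα₂ : 0 < α₂) :
    ¬ IsLocalMin (ffun n v₁ v₂ α₁ α₂) 0 := by
  intro hmin
  set ρ := v₁ / v₂ with hρ_def
  have hρ : 0 < ρ := div_pos hv₁ hv₂
  have hn' : (2 : ℝ) ≤ n := by exact_mod_cast hn
  set p : ℝ := ((n : ℝ) - 1) / n with hp_def
  have hp₀ : 0 < p := div_pos (by linarith) (by linarith)
  have hp₁ : p < 1 := (div_lt_one (by linarith)).2 (by linarith)
  have hcont : ContinuousAt (fun s : ℝ => s ^ ((1 : ℝ) / n) - 1) 1 :=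
    (Real.continuousAt_rpow_const 1 _ (Or.inl one_ne_zero)).sub continuousAt_const
  have htend : Filter.Tendsto (fun s : ℝ => s ^ ((1 : ℝ) / n) - 1) (nhds 1) (nhds 0) := by
    simpa [ContinuousAt] using hcont
  obtain ⟨δ, hδ, hball⟩ := Metric.eventually_nhds_iff.1 (htend.eventually hmin)
  obtain ⟨e, he₀, he⟩ := exists_between (show 0 < min δ (min 1 ρ⁻¹) by positivity)
  obtain ⟨heδ, he₁, heρ⟩ : e < δ ∧ e < 1 ∧ e < ρ⁻¹ := by simpa using he
  have heρ₁ : e * ρ < 1 := by simpa [hρ.ne'] using mul_lt_mul_of_pos_right heρ hρ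
  have heρ₀ : 0 < e * ρ := mul_pos he₀ hρ
  have hzero : ffun n v₁ v₂ α₁ α₂ 0 = α₁ + α₂ := by simp [ffun, gfun]
  have hplus := hball (y := 1 + e) (by simpa [Real.dist_eq, abs_of_pos he₀] using heδ)
  have hminus := hball (y := 1 - e) (by simpa [Real.dist_eq, abs_of_pos he₀] using heδ)
  have eplus : 1 - (1 + e - 1) * ρ = 1 - e * ρ := by ring
  have eminus : 1 - (1 - e - 1) * ρ = 1 + e * ρ := by ring
  rw [hzero, ffun_rpow_one_div_sub_one (by omega) _ _ _ _ (by linarith)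
    (by rw [← hρ_def, eplus]; linarith), ← hρ_def, ← hp_def, eplus] at hplus
  rw [hzero, ffun_rpow_one_div_sub_one (by omega) _ _ _ _ (by linarith)
    (by rw [← hρ_def, eminus]; linarith), ← hρ_def, ← hp_def, eminus] at hminus
  have h₁ := mul_lt_mul_of_pos_left
    (one_add_rpow_add_one_sub_rpow_lt_two hp₀ hp₁ he₀ he₁) hα₁
  have h₂ := mul_lt_mul_of_pos_left
    (one_add_rpow_add_one_sub_rpow_lt_two hp₀ hp₁ heρ₀ heρ₁) hα₂
  linarith
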